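/- Let K : ℝ → ℝ be strictly positive, measurable and integrable with ∫_ℝ K = 1. Let φ be a continuous solution of the steady Whitham equation with wave speed μ > 0 (relative to K) that is even, strictly decreasing on [0, ∞), and satisfies 0 < φ(x) ≤ φ(0) = αμ/2 for all x ∈ ℝ, where α ∈ (0,1] is the relative height. Then μ < 2/(2 − α). -/

import Mathlib

open Real Filter MeasureTheory

/-- The convolution operator `Lf(x) = ∫_ℝ K(x−y) f(y) dy`. -/
noncomputable def Lop (K f : ℝ → ℝ) (x : ℝ) : ℝ := ∫ y : ℝ, K (x - y) * f y

/-- A solution of the steady Whitham equation with wave speed `μ`, relative to the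
kernel `K`: a bounded measurable `φ` satisfying `−μφ + Lφ + φ² = 0` pointwise. -/
def IsSolution (K : ℝ → ℝ) (μ : ℝ) (φ : ℝ → ℝ) : Prop :=
  Measurable φ ∧ (∃ C : ℝ, ∀ x : ℝ, |φ x| ≤ C) ∧
    ∀ x : ℝ, -μ * φ x + Lop K φ x + (φ x) ^ 2 = 0

/-- Averaging a function against a strictly positive kernel of unit mass gives strictly less than
an upper bound that the function stays below on a set of positive measure. -/
theorem Lop_lt_of_le {K f : ℝ → ℝ} (hKpos : ∀ x : ℝ, 0 < K x) (hKint : Integrable K)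
    (hKone : (∫ x : ℝ, K x) = 1) (hf : Measurable f) {B C : ℝ} (hB : ∀ x, |f x| ≤ B)
    (hC : ∀ x, f x ≤ C) {s : Set ℝ} (hs : volume s ≠ 0) (hlt : ∀ x ∈ s, f x < C) (x : ℝ) :
    Lop K f x < C := by
  have hK : Integrable fun y => K (x - y) := hKint.comp_sub_left x
  have hKf : Integrable fun y => K (x - y) * f y :=
    hK.mul_bdd (c := B) hf.aestronglyMeasurable (.of_forall hB)
  have hKC : Integrable fun y => K (x - y) * C := hK.mul_const C
  have hmass : ∫ y, K (x - y) * C = C := by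
    rw [integral_mul_const, integral_sub_left_eq_self K volume x, hKone, one_mul]
  have hpos : 0 < ∫ y, (K (x - y) * C - K (x - y) * f y) := by
    refine (integral_pos_iff_support_of_nonneg (fun y => ?_) (hKC.sub hKf)).2
      ((pos_iff_ne_zero.2 hs).trans_le (measure_mono fun y hy => ?_))
    · exact sub_nonneg.2 (mul_le_mul_of_nonneg_left (hC y) (hKpos _).le)
    · exact (sub_pos.2 (mul_lt_mul_of_pos_left (hlt y hy) (hKpos _))).ne'
  rw [integral_sub hKC hKf, hmass] at hpos
  exact sub_pos.1 hpos

theorem wave_speed_upper_bound (K : ℝ → ℝ)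
    (hKmeas : Measurable K) (hKpos : ∀ x : ℝ, 0 < K x)
    (hKint : Integrable K) (hKone : (∫ x : ℝ, K x) = 1)
    (φ : ℝ → ℝ) (μ α : ℝ) (hμ : 0 < μ) (hα : α ∈ Set.Ioc (0:ℝ) 1)
    (hφcont : Continuous φ) (hφ : IsSolution K μ φ)
    (heven : ∀ x : ℝ, φ (-x) = φ x)
    (hanti : StrictAntiOn φ (Set.Ici (0:ℝ)))
    (hrange : ∀ x : ℝ, 0 < φ x ∧ φ x ≤ φ 0)
    (hheight : φ 0 = α * μ / 2) :
    μ < 2 / (2 - α) := by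
  obtain ⟨hmeas, ⟨B, hB⟩, heq⟩ := hφ
  have hL : Lop K φ 0 < φ 0 :=
    Lop_lt_of_le hKpos hKint hKone hmeas hB (fun x => (hrange x).2) (s := Set.Ioi 0) (by simp)
      (fun y hy => hanti Set.self_mem_Ici (Set.mem_Ici.2 (le_of_lt hy)) hy) 0
  have hbound : μ - φ 0 < 1 := by
    refine lt_of_mul_lt_mul_right ?_ (hrange 0).1.le
    linarith [heq 0]
  rw [lt_div_iff₀ (by linarith [hα.2])]
  linarith
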